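/- Fix an integer d ≥ 3 and a non-integer real ν₁ > 0. There exists a nonzero real constant C = C(d, ν₁), depending only on d and ν₁, with the following property. Let κ : [−1,1] → ℝ be C^∞ on (−1,1), let r ≥ 1 be an integer, let ν₁ < ν₂ < ⋯ < ν_r be non-integer positive reals, let c_{j,1}, c_{j,−1} ∈ ℝ for j = 1,…,r, and let ε > 0 satisfy ε < ν₂ − ν₁ when r ≥ 2. Assume that for every integer s ≥ 0 there exist real polynomials p_{s,1}, p_{s,−1} such that, as t → 0⁺, κ^{(s)}(1−t) = p_{s,1}(t) + (−1)^s Σ_{j=1}^r c_{j,1} (Γ(ν_j+1)/Γ(ν_j+1−s)) t^{ν_j−s} + O(t^{ν₁+1+ε−s}) and κ^{(s)}(−1+t) = p_{s,−1}(t) + Σ_{j=1}^r c_{j,−1} (Γ(ν_j+1)/Γ(ν_j+1−s)) t^{ν_j−s} + O(t^{ν₁+1+ε−s}). Then: (i) if c_{1,1} ≠ −c_{1,−1}, then μ_k(κ) ∼ (c_{1,1}+c_{1,−1}) · C · k^{−d−2ν₁+1} along even k; (ii) if c_{1,1} ≠ c_{1,−1}, then μ_k(κ) ∼ (c_{1,1}−c_{1,−1})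 · C · k^{−d−2ν₁+1} along odd k. -/

import Mathlib

open Filter Asymptotics Real Set Topology

/-- Legendre polynomial of degree `k` in dimension `d` (Rodrigues formula). -/
noncomputable def legendreP (d k : ℕ) (t : ℝ) : ℝ :=
  (-1 / 2 : ℝ) ^ k * (Real.Gamma (((d : ℝ) - 1) / 2) / Real.Gamma ((k : ℝ) + ((d : ℝ) - 1) / 2)) *
    (1 - t ^ 2) ^ ((3 - (d : ℝ)) / 2) *
    iteratedDeriv k (fun s : ℝ => (1 - s ^ 2) ^ ((k : ℝ) + ((d : ℝ) - 3) / 2)) t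

/-- Surface area `ω_{p-1}` of the unit sphere in `ℝ^p`. -/
noncomputable def sphereSurface (p : ℕ) : ℝ :=
  2 * Real.pi ^ ((p : ℝ) / 2) / Real.Gamma ((p : ℝ) / 2)

/-- `μ_k(κ)`, the `k`-th Legendre coefficient of `κ` in dimension `d`. -/
noncomputable def legendreCoeff (d k : ℕ) (κ : ℝ → ℝ) : ℝ :=
  (sphereSurface (d - 1) / sphereSurface d) *
    ∫ t in (-1 : ℝ)..1, κ t * legendreP d k t * (1 - t ^ 2) ^ (((d : ℝ) - 3) / 2)


noncomputable def qp (β : ℝ) : ℕ → Polynomial ℝ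
  | 0 => 1
  | (j+1) => (1 - Polynomial.X ^ 2) * Polynomial.derivative (qp β j)
      - Polynomial.C (2 * (β - j)) * Polynomial.X * qp β j

lemma qp_deriv_of_ode (β : ℝ) (j : ℕ)
    (h : (1 - Polynomial.X ^ 2) * Polynomial.derivative (Polynomial.derivative (qp β j))
      - Polynomial.C (2 * (β - j) + 2) * Polynomial.X * Polynomial.derivative (qp β j)
      + Polynomial.C ((j:ℝ) * (j + 2 * (β - j) + 1)) * qp β j = 0) :
    Polynomial.derivative (qp β (j+1)) = - Polynomial.C (((j:ℝ)+1) * (j + 2 * (β - j))) * qp β j := by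
  have h2 : Polynomial.derivative (qp β (j+1)) + Polynomial.C (((j:ℝ)+1) * (j + 2 * (β - j))) * qp β j
      = (1 - Polynomial.X ^ 2) * Polynomial.derivative (Polynomial.derivative (qp β j))
      - Polynomial.C (2 * (β - j) + 2) * Polynomial.X * Polynomial.derivative (qp β j)
      + Polynomial.C ((j:ℝ) * (j + 2 * (β - j) + 1)) * qp β j := by
    simp only [qp, Polynomial.derivative_sub, Polynomial.derivative_mul, Polynomial.derivative_one,
      Polynomial.derivative_X, Polynomial.derivative_C, Polynomial.derivative_X_pow, map_add, map_mul, map_sub,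
      map_one, map_natCast, map_ofNat]
    push_cast
    ring_nf
    simp
  linear_combination h2 + h

lemma qp_ode (β : ℝ) (j : ℕ) :
    (1 - Polynomial.X ^ 2) * Polynomial.derivative (Polynomial.derivative (qp β j))
      - Polynomial.C (2 * (β - j) + 2) * Polynomial.X * Polynomial.derivative (qp β j)
      + Polynomial.C ((j:ℝ) * (j + 2 * (β - j) + 1)) * qp β j = 0 := by
  induction j with
  | zero => simp [qp]
  | succ j ih =>
    have h := qp_deriv_of_ode β j ih
    have h3 : qp β (j+1) = (1 - Polynomial.X ^ 2) * Polynomial.derivative (qp β j)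
      - Polynomial.C (2 * (β - j)) * Polynomial.X * qp β j := rfl
    rw [h]
    simp only [Polynomial.derivative_mul, Polynomial.derivative_neg, Polynomial.derivative_C]
    rw [h3]
    simp only [map_add, map_mul, map_sub, map_one, map_natCast, map_ofNat, Nat.cast_add, Nat.cast_one]
    ring

lemma qp_eval_one (β : ℝ) (j : ℕ) : (qp β (j+1)).eval 1 = -2 * (β - j) * (qp β j).eval 1 := by
  simp [qp]
lemma qp_eval_neg_one (β : ℝ) (j : ℕ) : (qp β (j+1)).eval (-1) = 2 * (β - j) * (qp β j).eval (-1) := by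
  simp [qp]

lemma qp_one (α : ℝ) (hα : 0 ≤ α) (k j : ℕ) (hj : j ≤ k) :
    (qp (k + α) j).eval 1 * Gamma (k - j + α + 1) = (-2)^j * Gamma (k + α + 1)
    ∧ (qp (k + α) j).eval (-1) * Gamma (k - j + α + 1) = 2^j * Gamma (k + α + 1) := by
  induction j with
  | zero => simp [qp]
  | succ j ih =>
    obtain ⟨h1, h2⟩ := ih (by omega)
    have hk : ((j:ℝ)+1) ≤ k := by exact_mod_cast hj
    have e : (k:ℝ) - j + α + 1 = (k - j + α) + 1 := by ring
    rw [e, Gamma_add_one (by linarith)] at h1 h2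
    rw [qp_eval_one, qp_eval_neg_one]
    have e2 : (k:ℝ) - ((j+1 : ℕ):ℝ) + α + 1 = k - j + α := by push_cast; ring
    rw [e2, pow_succ, pow_succ]
    constructor
    · linear_combination (-2) * h1
    · linear_combination (2) * h2

lemma one_sub_sq_pos {x : ℝ} (hx : x ∈ Ioo (-1:ℝ) 1) : 0 < 1 - x^2 := by
  nlinarith [hx.1, hx.2]

lemma hasDerivAt_wt (β : ℝ) {x : ℝ} (hx : x ∈ Ioo (-1:ℝ) 1) :
    HasDerivAt (fun s : ℝ => (1 - s^2)^β) (-2 * x * β * (1-x^2)^(β-1)) x := by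
  have h := one_sub_sq_pos hx
  have h1 : HasDerivAt (fun s : ℝ => 1 - s^2) (-2*x) x := by
    have := (hasDerivAt_pow 2 x).const_sub 1
    exact this.congr_deriv (by simp)
  exact h1.rpow_const (Or.inl h.ne')

lemma hasDerivAt_wt_poly (β : ℝ) (q : Polynomial ℝ) {x : ℝ} (hx : x ∈ Ioo (-1:ℝ) 1) :
    HasDerivAt (fun s : ℝ => (1 - s^2)^β * q.eval s)
      ((1-x^2)^(β-1) * ((1-x^2) * q.derivative.eval x - 2 * β * x * q.eval x)) x := by
  have h := one_sub_sq_pos hx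
  refine ((hasDerivAt_wt β hx).mul (q.hasDerivAt x)).congr_deriv ?_
  have : (1-x^2)^β = (1-x^2)^(β-1) * (1-x^2) := by
    rw [← rpow_add_one h.ne']; congr 1; ring
  rw [this]; ring

lemma hasDerivAt_qp (β : ℝ) (j : ℕ) {x : ℝ} (hx : x ∈ Ioo (-1:ℝ) 1) :
    HasDerivAt (fun s : ℝ => (1 - s^2)^(β - j) * (qp β j).eval s)
      ((1-x^2)^(β - (j+1 : ℕ)) * (qp β (j+1)).eval x) x := by
  refine (hasDerivAt_wt_poly (β - j) (qp β j) hx).congr_deriv ?_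
  push_cast
  rw [show β - (j + 1 : ℝ) = β - j - 1 by ring]
  simp [qp]

lemma iteratedDeriv_wt (β : ℝ) (j : ℕ) : ∀ x ∈ Ioo (-1:ℝ) 1,
    iteratedDeriv j (fun s : ℝ => (1 - s^2)^β) x = (1-x^2)^(β-j) * (qp β j).eval x := by
  induction j with
  | zero => intro x hx; simp [qp]
  | succ j ih =>
    intro x hx
    rw [iteratedDeriv_succ]
    have : (iteratedDeriv j (fun s : ℝ => (1 - s^2)^β)) =ᶠ[𝓝 x]
      fun x => (1-x^2)^(β-j) * (qp β j).eval x := by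
      filter_upwards [isOpen_Ioo.mem_nhds hx] with y hy using ih y hy
    rw [this.deriv_eq]
    exact (hasDerivAt_qp β j hx).deriv

noncomputable def LP (α : ℝ) (k : ℕ) : Polynomial ℝ :=
  Polynomial.C ((-1/2 : ℝ)^k * (Gamma (α+1) / Gamma (k+α+1))) * qp (k+α) k

lemma LP_ode (α : ℝ) (k : ℕ) (x : ℝ) :
    (1 - x^2) * (LP α k).derivative.derivative.eval x - 2*(α+1) * x * (LP α k).derivative.eval x
      + (k * (k + 2 * α + 1)) * (LP α k).eval x = 0 := by
  have h := congrArg (Polynomial.eval x) (qp_ode (k+α) k)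
  simp at h
  simp only [LP, Polynomial.derivative_C_mul, Polynomial.eval_mul, Polynomial.eval_C]
  linear_combination ((-1/2 : ℝ)^k * (Gamma (α+1) / Gamma (k+α+1))) * h

lemma LP_one (α : ℝ) (hα : 0 ≤ α) (k : ℕ) : (LP α k).eval 1 = 1 ∧ (LP α k).eval (-1) = (-1)^k := by
  obtain ⟨h1, h2⟩ := qp_one α hα k k le_rfl
  have e : (k:ℝ) - k + α + 1 = α + 1 := by ring
  rw [e] at h1 h2
  have g1 : 0 < Gamma (α+1) := Gamma_pos_of_pos (by linarith)
  have g2 : 0 < Gamma (k+α+1) := Gamma_pos_of_pos (by positivity)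
  simp only [LP, Polynomial.eval_mul, Polynomial.eval_C]
  constructor
  · calc _ = (-1/2 : ℝ)^k * ((qp (k + α) k).eval 1 * Gamma (α + 1)) / Gamma (k+α+1) := by ring
      _ = ((-1/2 : ℝ)^k * (-2)^k) * (Gamma (k+α+1) / Gamma (k+α+1)) := by rw [h1]; ring
      _ = 1 := by rw [div_self g2.ne', ← mul_pow]; norm_num
  · calc _ = (-1/2 : ℝ)^k * ((qp (k + α) k).eval (-1) * Gamma (α + 1)) / Gamma (k+α+1) := by ring
      _ = ((-1/2 : ℝ)^k * (2)^k) * (Gamma (k+α+1) / Gamma (k+α+1)) := by rw [h2]; ring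
      _ = _ := by rw [div_self g2.ne', ← mul_pow]; norm_num

lemma LP_bound (α : ℝ) (hα : 0 ≤ α) (k : ℕ) (hk : 1 ≤ k) (x : ℝ) (hx : x ∈ Ioo (-1:ℝ) 1) :
    |(LP α k).eval x| ≤ 1 := by
  obtain ⟨h1, h2⟩ := LP_one α hα k
  have hk' : (1:ℝ) ≤ k := by exact_mod_cast hk
  set l : ℝ := k * (k + 2 * α + 1) with hl
  have hlpos : 0 < l := by positivity
  set P := LP α k
  let F : ℝ → ℝ := fun t => l * (P.eval t)^2 + (1 - t^2) * (P.derivative.eval t)^2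
  have hF : ∀ t, HasDerivAt F (2 * (2 * α + 1) * t * (P.derivative.eval t)^2) t := by
    intro t
    have a1 := ((P.hasDerivAt t).pow 2).const_mul l
    have a2 := ((hasDerivAt_pow 2 t).const_sub 1).mul ((P.derivative.hasDerivAt t).pow 2)
    refine (a1.add a2).congr_deriv ?_
    have := LP_ode α k t
    simp only [Pi.pow_apply]
    push_cast
    linear_combination (2 * P.derivative.eval t) * this
  have hc : Continuous F := continuous_iff_continuousAt.2 fun t => (hF t).continuousAt
  have hle : F x ≤ l := by
    rcases le_total 0 x with h0 | h0
    · have hm : MonotoneOn F (Icc 0 1) := by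
        apply monotoneOn_of_deriv_nonneg (convex_Icc 0 1) hc.continuousOn
        · exact fun t _ => (hF t).differentiableAt.differentiableWithinAt
        · intro t ht
          rw [interior_Icc] at ht
          rw [(hF t).deriv]
          have := ht.1
          positivity
      have := hm ⟨h0, hx.2.le⟩ ⟨zero_le_one, le_rfl⟩ hx.2.le
      simpa [F, h1] using this
    · have hm : AntitoneOn F (Icc (-1) 0) := by
        apply antitoneOn_of_deriv_nonpos (convex_Icc (-1) 0) hc.continuousOn
        · exact fun t _ => (hF t).differentiableAt.differentiableWithinAt
        · intro t ht
          rw [interior_Icc] at ht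
          rw [(hF t).deriv]
          have := ht.2
          have h5 : 0 ≤ 2 * (2 * α + 1) * (P.derivative.eval t)^2 := by positivity
          nlinarith
      have := hm ⟨le_rfl, by norm_num⟩ ⟨hx.1.le, h0⟩ hx.1.le
      simpa [F, h2, ← pow_mul, mul_comm k 2] using this
  have hpos := one_sub_sq_pos hx
  have h3 : l * (P.eval x)^2 ≤ l := by
    have : 0 ≤ (1 - x^2) * (P.derivative.eval x)^2 := by positivity
    simp only [F] at hle
    linarith
  have h4 : (P.eval x)^2 ≤ 1 := by
    by_contra hh
    push Not at hh
    nlinarith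
  exact abs_le_one_iff_mul_self_le_one.2 (by nlinarith)

lemma wt_le_one {x : ℝ} : 1 - x^2 ≤ 1 := by nlinarith [sq_nonneg x]

lemma integrable_wt (γ : ℝ) (hγ : -1 < γ) :
    IntervalIntegrable (fun x : ℝ => (1-x^2)^γ) MeasureTheory.volume (-1) 1 := by
  rcases le_or_gt 0 γ with h | h
  · apply ContinuousOn.intervalIntegrable
    exact ContinuousOn.rpow_const (by fun_prop) (fun x _ => Or.inr h)
  · have i1 : IntervalIntegrable (fun x : ℝ => (1-x)^γ) MeasureTheory.volume (-1) 1 := by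
      have := (intervalIntegral.intervalIntegrable_rpow' (a := 2) (b := 0) hγ).comp_sub_left 1
      norm_num at this
      exact this
    have i2 : IntervalIntegrable (fun x : ℝ => (1+x)^γ) MeasureTheory.volume (-1) 1 := by
      have := (intervalIntegral.intervalIntegrable_rpow' (a := 0) (b := 2) hγ).comp_add_left 1
      norm_num at this
      exact this
    have i3 := i1.add i2
    rw [intervalIntegrable_iff_integrableOn_Ioo_of_le (by norm_num)] at i3 ⊢
    refine i3.mono' ?_ ?_
    · apply ContinuousOn.aestronglyMeasurable _ measurableSet_Ioo
      exact ContinuousOn.rpow_const (by fun_prop) (fun x hx => Or.inl (one_sub_sq_pos hx).ne')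
    · refine (MeasureTheory.ae_restrict_iff' measurableSet_Ioo).2 (Eventually.of_forall fun x hx => ?_)
      have a1 : 0 < 1 - x := by linarith [hx.2]
      have a2 : 0 < 1 + x := by linarith [hx.1]
      have e : (1 - x^2) = (1-x)*(1+x) := by ring
      rw [e, mul_rpow a1.le a2.le, Real.norm_of_nonneg (by positivity)]
      have p1 : 0 < (1-x)^γ := by positivity
      have p2 : 0 < (1+x)^γ := by positivity
      rcases le_total 0 x with h0 | h0
      · have : (1+x)^γ ≤ 1 := rpow_le_one_of_one_le_of_nonpos (by linarith) h.le
        nlinarith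
      · have : (1-x)^γ ≤ 1 := rpow_le_one_of_one_le_of_nonpos (by linarith) h.le
        nlinarith

lemma integrable_of_bd {f : ℝ → ℝ} {γ C : ℝ} (hγ : -1 < γ) (hf : ContinuousOn f (Ioo (-1) 1))
    (hb : ∀ x ∈ Ioo (-1:ℝ) 1, |f x| ≤ C * (1-x^2)^γ) :
    IntervalIntegrable f MeasureTheory.volume (-1) 1 ∧
      |∫ x in (-1:ℝ)..1, f x| ≤ C * ∫ x in (-1:ℝ)..1, (1-x^2)^γ := by
  have i := (integrable_wt γ hγ).const_mul C
  have i' := i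
  rw [intervalIntegrable_iff_integrableOn_Ioo_of_le (by norm_num)] at i
  have hae : ∀ᵐ x ∂(MeasureTheory.volume.restrict (Ioo (-1:ℝ) 1)), ‖f x‖ ≤ C * (1-x^2)^γ :=
    (MeasureTheory.ae_restrict_iff' measurableSet_Ioo).2 (Eventually.of_forall fun x hx => hb x hx)
  constructor
  · rw [intervalIntegrable_iff_integrableOn_Ioo_of_le (by norm_num)]
    exact i.mono' (hf.aestronglyMeasurable measurableSet_Ioo) hae
  · rw [← intervalIntegral.integral_const_mul, intervalIntegral.integral_of_le (by norm_num),
      intervalIntegral.integral_of_le (by norm_num), MeasureTheory.integral_Ioc_eq_integral_Ioo,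
      MeasureTheory.integral_Ioc_eq_integral_Ioo]
    exact MeasureTheory.norm_integral_le_of_norm_le i hae

lemma tendsto_zero_of_bd {f : ℝ → ℝ} {δ C : ℝ} (hδ : 0 < δ)
    (hb : ∀ x ∈ Ioo (-1:ℝ) 1, |f x| ≤ C * (1-x^2)^δ) :
    Tendsto f (𝓝[>] (-1)) (𝓝 0) ∧ Tendsto f (𝓝[<] 1) (𝓝 0) := by
  have hc : Continuous (fun x : ℝ => C * (1-x^2)^δ) :=
    continuous_const.mul (Continuous.rpow_const (by fun_prop) (fun _ => Or.inr hδ.le))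
  constructor
  · apply squeeze_zero_norm' (a := fun x => C * (1-x^2)^δ)
    · filter_upwards [Ioo_mem_nhdsGT (show (-1:ℝ) < 1 by norm_num)] with x hx using hb x hx
    · have := (hc.tendsto (-1)).mono_left (nhdsWithin_le_nhds (s := Ioi (-1)))
      simpa [zero_rpow hδ.ne'] using this
  · apply squeeze_zero_norm' (a := fun x => C * (1-x^2)^δ)
    · filter_upwards [Ioo_mem_nhdsLT (show (-1:ℝ) < 1 by norm_num)] with x hx using hb x hx
    · have := (hc.tendsto 1).mono_left (nhdsWithin_le_nhds (s := Iio 1))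
      simpa [zero_rpow hδ.ne'] using this

structure JB (X : ℝ) (F : ℕ → ℝ → ℝ) : Prop where
  der : ∀ s, ∀ x ∈ Ioo (-1:ℝ) 1, HasDerivAt (F s) (F (s+1) x) x
  bd : ∀ s : ℕ, ∃ C : ℝ, 0 ≤ C ∧ ∀ x ∈ Ioo (-1:ℝ) 1, |F s x| ≤ C * (1-x^2)^(min 0 (X - s))

lemma JB.cont {X : ℝ} {F : ℕ → ℝ → ℝ} (h : JB X F) (s : ℕ) : ContinuousOn (F s) (Ioo (-1) 1) :=
  fun x hx => (h.der s x hx).continuousAt.continuousWithinAt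

noncomputable def Lop (α : ℝ) (F : ℕ → ℝ → ℝ) : ℕ → ℝ → ℝ := fun s x =>
  (1 - x^2) * F (s+2) x - (2*s + 2*α + 2) * x * F (s+1) x - s * (s + 2*α + 1) * F s x

lemma JB_Lop {α X : ℝ} {F : ℕ → ℝ → ℝ} (h : JB X F) : JB (X-1) (Lop α F) := by
  constructor
  · intro s x hx
    have d0 := h.der s x hx
    have d1 := h.der (s+1) x hx
    have d2 := h.der (s+2) x hx
    have e := (((hasDerivAt_pow 2 x).const_sub 1).mul d2).sub
      ((((hasDerivAt_id x).const_mul ((2*s + 2*α + 2 : ℝ))).mul d1)) |>.sub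
      (d0.const_mul (s * (s + 2*α + 1 : ℝ)))
    refine HasDerivAt.congr_deriv e ?_
    simp only [Lop, id]
    push_cast
    ring_nf
  · intro s
    obtain ⟨C0, hC0, h0⟩ := h.bd s
    obtain ⟨C1, hC1, h1⟩ := h.bd (s+1)
    obtain ⟨C2, hC2, h2⟩ := h.bd (s+2)
    refine ⟨C2 + |2*s + 2*α + 2| * C1 + |s * (s + 2*α + 1)| * C0, by positivity, fun x hx => ?_⟩
    have hp := one_sub_sq_pos hx
    have hx1 : |x| ≤ 1 := abs_le.2 ⟨hx.1.le, hx.2.le⟩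
    set W := (1-x^2)^(min 0 (X - 1 - s)) with hW
    have hWp : 0 < W := by positivity
    have k0 : (1-x^2)^(min 0 (X - s)) ≤ W :=
      rpow_le_rpow_of_exponent_ge hp wt_le_one (min_le_min le_rfl (by linarith))
    have k1 : (1-x^2)^(min 0 (X - (s+1:ℕ))) ≤ W :=
      rpow_le_rpow_of_exponent_ge hp wt_le_one (min_le_min le_rfl (by push_cast; linarith))
    have k2 : (1-x^2) * (1-x^2)^(min 0 (X - (s+2:ℕ))) ≤ W := by
      rw [mul_comm, ← rpow_add_one hp.ne']
      apply rpow_le_rpow_of_exponent_ge hp wt_le_one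
      push_cast
      rcases le_total 0 (X - (s+2)) with q | q
      · rw [min_eq_left q]
        have := min_le_left 0 (X - 1 - s)
        linarith
      · rw [min_eq_right q]
        have := min_le_right 0 (X - 1 - s)
        linarith
    have b0 : |F s x| ≤ C0 * W := (h0 x hx).trans (by gcongr)
    have b1 : |F (s+1) x| ≤ C1 * W := (h1 x hx).trans (by gcongr)
    have b2 : (1-x^2) * |F (s+2) x| ≤ C2 * W := by
      calc _ ≤ (1-x^2) * (C2 * (1-x^2)^(min 0 (X - (s+2:ℕ)))) := by gcongr; exact h2 x hx
        _ = C2 * ((1-x^2) * (1-x^2)^(min 0 (X - (s+2:ℕ)))) := by ring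
        _ ≤ _ := by gcongr
    calc |Lop α F s x| ≤ |(1 - x^2) * F (s+2) x| + |(2*s + 2*α + 2) * x * F (s+1) x|
          + |s * (s + 2*α + 1) * F s x| := by
          unfold Lop
          exact (abs_sub _ _).trans (add_le_add (abs_sub _ _) le_rfl)
      _ = (1-x^2) * |F (s+2) x| + |2*s + 2*α + 2| * (|x| * |F (s+1) x|)
          + |s * (s + 2*α + 1)| * |F s x| := by
          rw [abs_mul, abs_of_pos hp, abs_mul, abs_mul, abs_mul (s * (s + 2*α + 1)), mul_assoc]
      _ ≤ C2 * W + |2*s + 2*α + 2| * (1 * (C1 * W)) + |s * (s + 2*α + 1)| * (C0 * W) := by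
          gcongr
      _ = _ := by ring

lemma poly_bd (p : Polynomial ℝ) : ∃ M : ℝ, 0 ≤ M ∧ ∀ x ∈ Ioo (-1:ℝ) 1, |p.eval x| ≤ M := by
  obtain ⟨M, hM⟩ := isCompact_Icc.exists_bound_of_continuousOn (s := Icc (-1:ℝ) 1)
    (f := fun x => p.eval x) p.continuous.continuousOn
  exact ⟨|M|, abs_nonneg _, fun x hx => (hM x (Ioo_subset_Icc_self hx)).trans (le_abs_self M)⟩

lemma wt_cont (α : ℝ) : ContinuousOn (fun x : ℝ => (1-x^2)^α) (Ioo (-1) 1) :=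
  ContinuousOn.rpow_const (by fun_prop) (fun x hx => Or.inl (one_sub_sq_pos hx).ne')

lemma JB_int_bd {α X : ℝ} {F : ℕ → ℝ → ℝ} (hα : 0 ≤ α) (h : JB X F) (hX : -1 < X + α) (p : Polynomial ℝ) :
    IntervalIntegrable (fun x => F 0 x * p.eval x * (1-x^2)^α) MeasureTheory.volume (-1) 1 := by
  obtain ⟨C, hC, hb⟩ := h.bd 0
  obtain ⟨M, hM, hp⟩ := poly_bd p
  refine (integrable_of_bd (γ := min 0 X + α) (C := C * M) ?_ ?_ ?_).1
  · rcases le_total 0 X with q | q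
    · rw [min_eq_left q]; linarith
    · rw [min_eq_right q]; linarith
  · exact ((h.cont 0).mul p.continuous.continuousOn).mul (wt_cont α)
  · intro x hx
    have hw := one_sub_sq_pos hx
    have hb' := hb x hx
    simp only [Nat.cast_zero, sub_zero] at hb'
    rw [rpow_add hw, abs_mul, abs_mul, abs_of_pos (rpow_pos_of_pos hw α)]
    calc _ ≤ (C * (1-x^2)^(min 0 X)) * M * (1-x^2)^α := by gcongr; exact hp x hx
      _ = _ := by ring

lemma ibp {α X : ℝ} {F : ℕ → ℝ → ℝ} (hα : 0 ≤ α) (h : JB X F) (hX : 0 < X + α) (k : ℕ) :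
    ∫ x in (-1:ℝ)..1, Lop α F 0 x * (LP α k).eval x * (1-x^2)^α
      = -(k * (k + 2*α + 1)) * ∫ x in (-1:ℝ)..1, F 0 x * (LP α k).eval x * (1-x^2)^α := by
  have hL : JB (X-1) (Lop α F) := JB_Lop h
  have i1 := JB_int_bd hα hL (by linarith) (LP α k)
  have i2 := (JB_int_bd hα h (by linarith) (LP α k)).const_mul (k * (k + 2*α + 1) : ℝ)
  set P := LP α k with hP
  let G : ℝ → ℝ := fun x => (1-x^2)^(α+1) * (F 1 x * P.eval x - F 0 x * P.derivative.eval x)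
  obtain ⟨C0, hC0, h0⟩ := h.bd 0
  obtain ⟨C1, hC1, h1⟩ := h.bd 1
  obtain ⟨M, hM, hp⟩ := poly_bd P
  obtain ⟨M', hM', hp'⟩ := poly_bd P.derivative
  have hG : ∀ x ∈ Ioo (-1:ℝ) 1, |G x| ≤ (C1 * M + C0 * M') * (1-x^2)^(min 0 (X-1) + (α+1)) := by
    intro x hx
    have hw := one_sub_sq_pos hx
    have b1 := h1 x hx
    have b0 : |F 0 x| ≤ C0 * (1-x^2)^(min 0 (X-1)) := by
      refine (h0 x hx).trans ?_
      gcongr 1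
      apply rpow_le_rpow_of_exponent_ge hw wt_le_one (min_le_min le_rfl (by simp))
    simp only [Nat.cast_one] at b1
    rw [rpow_add hw, abs_mul, abs_of_pos (rpow_pos_of_pos hw (α+1))]
    calc _ ≤ (1-x^2)^(α+1) * (|F 1 x| * |P.eval x| + |F 0 x| * |P.derivative.eval x|) := by
          gcongr
          rw [← abs_mul, ← abs_mul]; exact abs_sub _ _
      _ ≤ (1-x^2)^(α+1) * ((C1 * (1-x^2)^(min 0 (X-1))) * M + (C0 * (1-x^2)^(min 0 (X-1))) * M') := by
          gcongr
          · exact hp x hx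
          · exact hp' x hx
      _ = _ := by ring
  have hδ : 0 < min 0 (X-1) + (α+1) := by
    rcases le_total 0 (X-1) with q | q
    · rw [min_eq_left q]; linarith
    · rw [min_eq_right q]; linarith
  obtain ⟨t1, t2⟩ := tendsto_zero_of_bd hδ hG
  have hder : ∀ x ∈ Ioo (-1:ℝ) 1, HasDerivAt G (Lop α F 0 x * P.eval x * (1-x^2)^α
      + (k * (k + 2*α + 1)) * (F 0 x * P.eval x * (1-x^2)^α)) x := by
    intro x hx
    have hw := one_sub_sq_pos hx
    have e := (hasDerivAt_wt (α+1) hx).mul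
      (((h.der 1 x hx).mul (P.hasDerivAt x)).sub ((h.der 0 x hx).mul (P.derivative.hasDerivAt x)))
    refine HasDerivAt.congr_deriv e ?_
    have e1 : (1-x^2)^(α+1) = (1-x^2)^α * (1-x^2) := rpow_add_one hw.ne' α
    have e2 : α + 1 - 1 = α := by ring
    have ode := LP_ode α k x
    simp only [Lop, e1, e2, Pi.mul_apply, Pi.sub_apply, Nat.cast_zero]
    norm_num
    linear_combination (-(1-x^2)^α * F 0 x) * ode
  have key := intervalIntegral.integral_eq_sub_of_hasDerivAt_of_tendsto (by norm_num) hder (i1.add i2) t1 t2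
  rw [intervalIntegral.integral_add i1 i2, intervalIntegral.integral_const_mul] at key
  linarith

lemma decay {α : ℝ} (hα : 0 ≤ α) (m : ℕ) : ∀ (X : ℝ) (F : ℕ → ℝ → ℝ), JB X F → (m:ℝ) < X + α + 1 →
    ∃ K : ℝ, ∀ k : ℕ, 1 ≤ k →
      |∫ x in (-1:ℝ)..1, F 0 x * (LP α k).eval x * (1-x^2)^α| ≤ K / ((k:ℝ) * (k + 2*α + 1))^m := by
  induction m with
  | zero =>
    intro X F h hX
    simp only [Nat.cast_zero] at hX
    obtain ⟨C, hC, hb⟩ := h.bd 0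
    have hγ : -1 < min 0 X + α := by
      rcases le_total 0 X with q | q
      · rw [min_eq_left q]; linarith
      · rw [min_eq_right q]; linarith
    refine ⟨C * ∫ x in (-1:ℝ)..1, (1-x^2)^(min 0 X + α), fun k hk => ?_⟩
    rw [pow_zero, div_one]
    refine (integrable_of_bd hγ ?_ ?_).2
    · exact ((h.cont 0).mul (LP α k).continuous.continuousOn).mul (wt_cont α)
    · intro x hx
      have hw := one_sub_sq_pos hx
      have hb' := hb x hx
      simp only [Nat.cast_zero, sub_zero] at hb'
      rw [rpow_add hw, abs_mul, abs_mul, abs_of_pos (rpow_pos_of_pos hw α)]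
      calc _ ≤ (C * (1-x^2)^(min 0 X)) * 1 * (1-x^2)^α := by
            gcongr; exact LP_bound α hα k hk x hx
        _ = _ := by ring
  | succ m ih =>
    intro X F h hX
    push_cast at hX
    have hm : (0:ℝ) ≤ m := by positivity
    obtain ⟨K, hK⟩ := ih (X-1) (Lop α F) (JB_Lop h) (by linarith)
    refine ⟨K, fun k hk => ?_⟩
    have := hK k hk
    rw [ibp hα h (by linarith) k, abs_mul, abs_neg] at this
    have hk' : (1:ℝ) ≤ k := by exact_mod_cast hk
    have hl : 0 < (k:ℝ) * (k + 2*α + 1) := by positivity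
    rw [abs_of_pos hl, le_div_iff₀ (by positivity)] at this
    rw [le_div_iff₀ (by positivity), pow_succ]
    linarith

lemma beta_real (u v : ℝ) (hu : 0 < u) (hv : 0 < v) :
    ∫ x in (0:ℝ)..1, x^(u-1) * (1-x)^(v-1) = Gamma u * Gamma v / Gamma (u+v) := by
  have h := ProbabilityTheory.beta_eq_betaIntegralReal u v hu hv
  have e : Complex.betaIntegral u v = ((∫ x in (0:ℝ)..1, x^(u-1) * (1-x)^(v-1) : ℝ) : ℂ) := by
    rw [Complex.betaIntegral, ← intervalIntegral.integral_ofReal]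
    apply intervalIntegral.integral_congr
    intro x hx
    rw [uIcc_of_le zero_le_one] at hx
    simp only
    push_cast [Complex.ofReal_cpow hx.1, Complex.ofReal_cpow (sub_nonneg.2 hx.2)]
    rfl
  rw [e, Complex.ofReal_re] at h
  rw [← h]; rfl

lemma beta_real2 (a b : ℝ) (ha : 0 ≤ a) (hb : 0 ≤ b) :
    ∫ x in (-1:ℝ)..1, (1-x)^a * (1+x)^b =
      2^(a+b+1) * (Gamma (a+1) * Gamma (b+1) / Gamma (a+b+2)) := by
  have h := intervalIntegral.mul_integral_comp_mul_add (a := (0:ℝ)) (b := 1)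
    (f := fun x : ℝ => (1-x)^a * (1+x)^b) 2 (-1)
  norm_num at h
  rw [← h]
  have h2 := beta_real (b+1) (a+1) (by linarith) (by linarith)
  have h3 : ∫ x in (0:ℝ)..1, (1 - (2*x + -1))^a * (1 + (2*x + -1))^b
      = ∫ x in (0:ℝ)..1, 2^(a+b) * (x^(b+1-1) * (1-x)^(a+1-1)) := by
    apply intervalIntegral.integral_congr
    intro x hx
    rw [uIcc_of_le zero_le_one] at hx
    have e1 : 1 - (2*x + -1) = 2*(1-x) := by ring
    have e2 : 1 + (2*x + -1) = 2*x := by ring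
    simp only
    rw [e1, e2, mul_rpow (by norm_num) (sub_nonneg.2 hx.2), mul_rpow (by norm_num) hx.1,
      rpow_add (by norm_num)]
    simp only [add_sub_cancel_right]
    ring
  have h4 : ∫ x in (0:ℝ)..1, (1 - (2*x + -1))^a * (2*x)^b = ∫ x in (0:ℝ)..1, (1 - (2*x + -1))^a * (1 + (2*x + -1))^b := by
    congr 1; ext x; ring_nf
  first
  | rw [h3]
  | rw [h4, h3]
  rw [intervalIntegral.integral_const_mul, h2, rpow_add_one (by norm_num)]
  rw [show b + 1 + (a+1) = a + b + 2 by ring]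
  ring

lemma Jcont (a b : ℝ) (ha : 0 ≤ a) (hb : 0 ≤ b) (p : Polynomial ℝ) :
    Continuous (fun x : ℝ => (1-x)^a * (1+x)^b * p.eval x) :=
  ((Continuous.rpow_const (by fun_prop) (fun _ => Or.inr ha)).mul
    (Continuous.rpow_const (by fun_prop) (fun _ => Or.inr hb))).mul p.continuous

lemma Jstep (α ν : ℝ) (hα : 0 ≤ α) (hν : 0 < ν) (k j : ℕ) (hj : j + 1 ≤ k) :
    ∫ x in (-1:ℝ)..1, (1-x)^(ν+α) * (1+x)^(k - (j+1:ℕ) + α) * (qp (k+α) (j+1)).eval x =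
    (ν - k + j + 1) * ∫ x in (-1:ℝ)..1, (1-x)^(ν+α) * (1+x)^(k - j + α) * (qp (k+α) j).eval x := by
  have hk : (j:ℝ) + 1 ≤ k := by exact_mod_cast hj
  have c1 := Jcont (ν+α) (k - (j+1:ℕ) + α) (by linarith) (by push_cast; linarith) (qp (k+α) (j+1))
  have c2 := Jcont (ν+α) (k - j + α) (by linarith) (by linarith) (qp (k+α) j)
  have c3 := Jcont (ν+α+1) (k - j + α) (by linarith) (by linarith) (qp (k+α) j)
  have key := intervalIntegral.integral_eq_sub_of_hasDerivAt_of_le (a := -1) (b := 1) (by norm_num)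
    c3.continuousOn (f' := fun x => (1-x)^(ν+α) * (1+x)^(k - (j+1:ℕ) + α) * (qp (k+α) (j+1)).eval x
      - (ν - k + j + 1) * ((1-x)^(ν+α) * (1+x)^(k - j + α) * (qp (k+α) j).eval x)) ?_ ?_
  · rw [intervalIntegral.integral_sub (c1.intervalIntegrable _ _) ((c2.intervalIntegrable _ _).const_mul _),
      intervalIntegral.integral_const_mul] at key
    have z1 : (0:ℝ)^(ν+α+1) = 0 := zero_rpow (by linarith)
    have z2 : (0:ℝ)^(k-j+α) = 0 := zero_rpow (by linarith)
    simp only [sub_self, z1, add_neg_cancel, z2, zero_mul, mul_zero] at key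
    linarith
  · intro x hx
    have a1 : 0 < 1 - x := by linarith [hx.2]
    have a2 : 0 < 1 + x := by linarith [hx.1]
    have d1 := ((hasDerivAt_id x).const_sub 1).rpow_const (p := ν+α+1) (Or.inl a1.ne')
    have d2 := ((hasDerivAt_id x).const_add 1).rpow_const (p := (k:ℝ)-j+α) (Or.inl a2.ne')
    refine HasDerivAt.congr_deriv ((d1.mul d2).mul ((qp (k+α) j).hasDerivAt x)) ?_
    have e1 : (1-x)^(ν+α+1) = (1-x)^(ν+α) * (1-x) := rpow_add_one a1.ne' _
    have e2 : (1+x)^((k:ℝ)-j+α) = (1+x)^((k:ℝ)-j+α-1) * (1+x) := by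
      rw [← rpow_add_one a2.ne']; congr 1; ring
    have e3 : ν + α + 1 - 1 = ν + α := by ring
    have e4 : (k:ℝ) - (j+1:ℕ) + α = (k:ℝ)-j+α-1 := by push_cast; ring
    simp only [id, e1, e2, e3, e4, qp, Pi.mul_apply, Polynomial.eval_sub, Polynomial.eval_mul, Polynomial.eval_one,
      Polynomial.eval_pow, Polynomial.eval_X, Polynomial.eval_C]
    ring
  · exact (c1.sub (continuous_const.mul c2)).intervalIntegrable _ _

lemma Jall (α ν : ℝ) (hα : 0 ≤ α) (hν : 0 < ν) (k j : ℕ) (hj : j ≤ k) :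
    ∫ x in (-1:ℝ)..1, (1-x)^(ν+α) * (1+x)^(k - j + α) * (qp (k+α) j).eval x =
    (∏ i ∈ Finset.range j, (ν - k + i + 1)) * ∫ x in (-1:ℝ)..1, (1-x)^(ν+α) * (1+x)^(k + α) := by
  induction j with
  | zero => simp [qp]
  | succ j ih =>
    rw [Jstep α ν hα hν k j hj, ih (by omega), Finset.prod_range_succ]
    ring

noncomputable def Acoef (α ν : ℝ) (k : ℕ) : ℝ :=
  ∫ x in (-1:ℝ)..1, (1-x)^ν * (LP α k).eval x * (1-x^2)^α

lemma integral_congr_Ioo' {f g : ℝ → ℝ} (h : ∀ x ∈ Ioo (-1:ℝ) 1, f x = g x) :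
    ∫ x in (-1:ℝ)..1, f x = ∫ x in (-1:ℝ)..1, g x := by
  rw [intervalIntegral.integral_of_le (by norm_num), intervalIntegral.integral_of_le (by norm_num),
    MeasureTheory.integral_Ioc_eq_integral_Ioo, MeasureTheory.integral_Ioc_eq_integral_Ioo]
  exact MeasureTheory.setIntegral_congr_fun measurableSet_Ioo h

lemma Acoef_eq (α ν : ℝ) (hα : 0 ≤ α) (hν : 0 < ν) (k : ℕ) :
    Acoef α ν k = Gamma (α+1) * Gamma (ν+α+1) * 2^(ν+2*α+1) *
      ((∏ i ∈ Finset.range k, (-ν + i)) / Gamma (ν+2*α+2+k)) := by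
  have h1 : Acoef α ν k = ((-1/2 : ℝ)^k * (Gamma (α+1) / Gamma (k+α+1))) *
      ∫ x in (-1:ℝ)..1, (1-x)^(ν+α) * (1+x)^(k - k + α) * (qp (k+α) k).eval x := by
    rw [← intervalIntegral.integral_const_mul]
    apply integral_congr_Ioo'
    intro x hx
    have a1 : 0 < 1 - x := by linarith [hx.2]
    have a2 : 0 < 1 + x := by linarith [hx.1]
    simp only [LP, Polynomial.eval_mul, Polynomial.eval_C]
    rw [show 1 - x^2 = (1-x)*(1+x) by ring, mul_rpow a1.le a2.le, rpow_add a1, sub_self, zero_add]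
    ring
  rw [h1, Jall α ν hα hν k k le_rfl, beta_real2 _ _ (by linarith) (by positivity)]
  have h2 : ∏ i ∈ Finset.range k, (ν - k + i + 1) = (-1)^k * ∏ i ∈ Finset.range k, (-ν + i) := by
    rw [← Finset.prod_range_reflect]
    have hc : (-1:ℝ)^k = ∏ _i ∈ Finset.range k, (-1:ℝ) := by simp
    rw [hc, ← Finset.prod_mul_distrib]
    apply Finset.prod_congr rfl
    intro i hi
    have hi' := Finset.mem_range.1 hi
    rw [Nat.cast_sub (by omega), Nat.cast_sub (by omega)]
    push_cast; ring
  have h3 : (2:ℝ)^(ν + α + (k+α) + 1) = 2^k * 2^(ν+2*α+1) := by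
    rw [← rpow_natCast, ← rpow_add (by norm_num)]; congr 1; ring
  have h4 : Gamma (k+α+1) ≠ 0 := (Gamma_pos_of_pos (by positivity)).ne'
  rw [h2, h3, show ν + α + (k+α) + 2 = ν + 2*α+2+k by ring]
  have h5 : (-1/2 : ℝ)^k * (-1)^k * 2^k = 1 := by rw [← mul_pow, ← mul_pow]; norm_num
  calc _ = ((-1/2 : ℝ)^k * (-1)^k * 2^k) * (Gamma (k+α+1) / Gamma (k+α+1)) * (Gamma (α+1) * Gamma (ν+α+1) * 2^(ν+2*α+1) *
      ((∏ i ∈ Finset.range k, (-ν + i)) / Gamma (ν+2*α+2+k))) := by ring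
    _ = _ := by rw [h5, div_self h4]; ring

lemma Gamma_add_nat (s : ℝ) (hs : 0 < s) (n : ℕ) :
    Gamma (s + n) = Gamma s * ∏ i ∈ Finset.range n, (s + i) := by
  induction n with
  | zero => simp
  | succ n ih =>
    rw [Finset.prod_range_succ, ← mul_assoc, ← ih]
    push_cast
    rw [← add_assoc, Gamma_add_one (by positivity)]; ring

lemma Gamma_neg_ne (ν : ℝ) (hn : ∀ n : ℤ, ν ≠ n) : Gamma (-ν) ≠ 0 := by
  apply Gamma_ne_zero
  intro m h
  exact hn m (by push_cast; linarith)

noncomputable def Cc (α ν : ℝ) : ℝ := Gamma (α+1) * Gamma (ν+α+1) * 2^(ν+2*α+1) / Gamma (-ν)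

lemma Acoef_tendsto (α ν : ℝ) (hα : 0 ≤ α) (hν : 0 < ν) (hn : ∀ n : ℤ, ν ≠ n) :
    Tendsto (fun k : ℕ => Acoef α ν k * (k:ℝ)^(2*ν+2*α+2)) atTop (𝓝 (Cc α ν)) := by
  set s := ν+2*α+2 with hs
  have hspos : 0 < s := by positivity
  have g0 := Gamma_neg_ne ν hn
  have gs : Gamma s ≠ 0 := (Gamma_pos_of_pos hspos).ne'
  have t1 := GammaSeq_tendsto_Gamma (-ν)
  have t2 := GammaSeq_tendsto_Gamma s
  have t3 : Tendsto (fun k : ℕ => (s + k) / (-ν + k)) atTop (𝓝 1) := by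
    have := tendsto_add_mul_div_add_mul_atTop_nhds (𝕜 := ℝ) s (-ν) 1 (d := 1) one_ne_zero
    simpa using this
  have t4 := ((t2.div t1 g0).mul t3).const_mul (Gamma (α+1) * Gamma (ν+α+1) * 2^(ν+2*α+1) / Gamma s)
  have e : Gamma (α+1) * Gamma (ν+α+1) * 2^(ν+2*α+1) / Gamma s * (Gamma s / Gamma (-ν) * 1) = Cc α ν := by
    unfold Cc
    field_simp
  rw [e] at t4
  refine t4.congr' ?_
  filter_upwards [eventually_gt_atTop 0] with k hk
  have hk' : (0:ℝ) < k := by exact_mod_cast hk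
  rw [Acoef_eq α ν hα hν]
  simp only [Pi.div_apply, GammaSeq]
  rw [← hs, Gamma_add_nat s hspos k, Finset.prod_range_succ, Finset.prod_range_succ]
  have p1 : ∏ i ∈ Finset.range k, (s + i) ≠ 0 := Finset.prod_ne_zero_iff.2 fun i _ => by positivity
  have hne : ∀ i : ℕ, -ν + i ≠ 0 := fun i h => hn i (by push_cast; linarith)
  have p2 : ∏ i ∈ Finset.range k, (-ν + i) ≠ 0 := Finset.prod_ne_zero_iff.2 fun i _ => hne i
  have p3 := hne k
  have p4 : s + k ≠ 0 := by positivity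
  have e1 : (k:ℝ)^s = (k:ℝ)^(2*ν+2*α+2) * (k:ℝ)^(-ν) := by
    rw [← rpow_add hk']; congr 1; rw [hs]; ring
  rw [e1]
  have p5 : (k:ℝ)^(-ν) ≠ 0 := (rpow_pos_of_pos hk' _).ne'
  have p6 : (k.factorial:ℝ) ≠ 0 := by positivity
  field_simp




lemma legendreP_eq (d k : ℕ) (x : ℝ) (hx : x ∈ Ioo (-1:ℝ) 1) :
    legendreP d k x = (LP (((d:ℝ)-3)/2) k).eval x := by
  have hw := one_sub_sq_pos hx
  unfold legendreP LP
  rw [iteratedDeriv_wt _ _ x hx]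
  simp only [Polynomial.eval_mul, Polynomial.eval_C]
  rw [show ((d:ℝ)-1)/2 = ((d:ℝ)-3)/2 + 1 by ring, show (k:ℝ) + (((d:ℝ)-3)/2 + 1) = k + ((d:ℝ)-3)/2 + 1 by ring]
  have : (1-x^2)^((3-(d:ℝ))/2) * (1-x^2)^((k:ℝ) + ((d:ℝ)-3)/2 - k) = 1 := by
    rw [← rpow_add hw, show (3-(d:ℝ))/2 + ((k:ℝ) + ((d:ℝ)-3)/2 - k) = 0 by ring, rpow_zero]
  linear_combination ((-1 / 2 : ℝ) ^ k * (Gamma (((d:ℝ)-3)/2 + 1) / Gamma (k + ((d:ℝ)-3)/2 + 1)) *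
    (qp (k + ((d:ℝ)-3)/2) k).eval x) * this

lemma qp_parity (β : ℝ) (j : ℕ) : (qp β j).comp (-Polynomial.X) = (-1)^j * qp β j := by
  induction j with
  | zero => simp [qp]
  | succ j ih =>
    have h := congrArg Polynomial.derivative ih
    have hc : ((-1 : Polynomial ℝ)^j) = Polynomial.C ((-1)^j) := by simp
    rw [hc, Polynomial.derivative_comp, Polynomial.derivative_C_mul, ← hc] at h
    simp at h
    simp only [qp, Polynomial.sub_comp, Polynomial.mul_comp, Polynomial.one_comp, Polynomial.pow_comp,
      Polynomial.X_comp, Polynomial.C_comp, ih, pow_succ]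
    linear_combination (-(1 - Polynomial.X^2)) * h

lemma LP_neg (α : ℝ) (k : ℕ) (x : ℝ) : (LP α k).eval (-x) = (-1)^k * (LP α k).eval x := by
  have h := congrArg (Polynomial.eval x) (qp_parity (k+α) k)
  simp at h
  simp only [LP, Polynomial.eval_mul, Polynomial.eval_C, h]
  ring

lemma Acoef_neg (α ν : ℝ) (k : ℕ) :
    ∫ x in (-1:ℝ)..1, (1+x)^ν * (LP α k).eval x * (1-x^2)^α = (-1)^k * Acoef α ν k := by
  have h := intervalIntegral.integral_comp_neg (a := -1) (b := 1)
    (fun x : ℝ => (1+x)^ν * (LP α k).eval x * (1-x^2)^α)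
  rw [neg_neg] at h
  rw [← h, Acoef, ← intervalIntegral.integral_const_mul]
  congr 1; ext x
  rw [LP_neg, neg_sq, ← sub_eq_add_neg]; ring

lemma bd_global {f : ℝ → ℝ} {e : ℝ} (he : e ≤ 0) (hf : ContinuousOn f (Ioo (-1) 1))
    (h1 : (fun t => f (1-t)) =O[𝓝[>] (0:ℝ)] fun t => t^e)
    (h2 : (fun t => f (-1+t)) =O[𝓝[>] (0:ℝ)] fun t => t^e) :
    ∃ C : ℝ, 0 ≤ C ∧ ∀ x ∈ Ioo (-1:ℝ) 1, |f x| ≤ C * (1-x^2)^e := by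
  obtain ⟨C1, h1⟩ := h1.bound
  obtain ⟨C2, h2⟩ := h2.bound
  obtain ⟨δ1, hδ1, h1⟩ := mem_nhdsGT_iff_exists_Ioo_subset.1 h1
  obtain ⟨δ2, hδ2, h2⟩ := mem_nhdsGT_iff_exists_Ioo_subset.1 h2
  simp only [mem_Ioi] at hδ1 hδ2
  obtain ⟨M, hM⟩ := isCompact_Icc.exists_bound_of_continuousOn (s := Icc (-1+δ2) (1-δ1)) (f := f)
    (hf.mono fun x hx => ⟨by linarith [hx.1], by linarith [hx.2]⟩)
  refine ⟨|C1| * 2^(-e) + |C2| * 2^(-e) + |M|, by positivity, fun x hx => ?_⟩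
  have hw := one_sub_sq_pos hx
  have a1 : 0 < 1 - x := by linarith [hx.2]
  have a2 : 0 < 1 + x := by linarith [hx.1]
  have e0 : 1 - x^2 = (1-x)*(1+x) := by ring
  have hwe : 0 < (1-x^2)^e := by positivity
  have b1 : (1-x)^e ≤ 2^(-e) * (1-x^2)^e := by
    rw [e0, mul_rpow a1.le a2.le]
    have : 1 ≤ 2^(-e) * (1+x)^e := by
      calc (1:ℝ) = (1+x)^(-e) * (1+x)^e := by rw [← rpow_add a2]; simp
        _ ≤ _ := mul_le_mul_of_nonneg_right
          (rpow_le_rpow a2.le (by linarith [hx.2]) (by linarith)) (by positivity)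
    have p : 0 < (1-x)^e := by positivity
    nlinarith
  have b2 : (1+x)^e ≤ 2^(-e) * (1-x^2)^e := by
    rw [e0, mul_rpow a1.le a2.le]
    have : 1 ≤ 2^(-e) * (1-x)^e := by
      calc (1:ℝ) = (1-x)^(-e) * (1-x)^e := by rw [← rpow_add a1]; simp
        _ ≤ _ := mul_le_mul_of_nonneg_right
          (rpow_le_rpow a1.le (by linarith [hx.1]) (by linarith)) (by positivity)
    have p : 0 < (1+x)^e := by positivity
    nlinarith
  have b3 : 1 ≤ (1-x^2)^e := one_le_rpow_of_pos_of_le_one_of_nonpos hw wt_le_one he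
  have q1 : 0 ≤ |C1| * 2^(-e) * (1-x^2)^e := by positivity
  have q2 : 0 ≤ |C2| * 2^(-e) * (1-x^2)^e := by positivity
  have q3 : 0 ≤ |M| * (1-x^2)^e := by positivity
  rw [add_mul, add_mul]
  by_cases c1 : 1 - x < δ1
  · have := h1 (show (1-x) ∈ Ioo 0 δ1 from ⟨a1, c1⟩)
    simp only [mem_ofPred_eq, sub_sub_cancel, Real.norm_eq_abs] at this
    rw [abs_of_pos (rpow_pos_of_pos a1 e)] at this
    have : |f x| ≤ |C1| * (2^(-e) * (1-x^2)^e) := by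
      refine this.trans (mul_le_mul (le_abs_self _) b1 (by positivity) (by positivity))
    linarith
  · by_cases c2 : 1 + x < δ2
    · have := h2 (show (1+x) ∈ Ioo 0 δ2 from ⟨a2, c2⟩)
      simp only [mem_ofPred_eq, neg_add_cancel_left, Real.norm_eq_abs] at this
      rw [abs_of_pos (rpow_pos_of_pos a2 e)] at this
      have : |f x| ≤ |C2| * (2^(-e) * (1-x^2)^e) := by
        refine this.trans (mul_le_mul (le_abs_self _) b2 (by positivity) (by positivity))
      linarith
    · have := hM x ⟨by linarith, by linarith⟩
      rw [Real.norm_eq_abs] at this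
      have : |f x| ≤ |M| * (1-x^2)^e := by
        have := le_abs_self M
        nlinarith [abs_nonneg M]
      linarith

noncomputable def Sg (r : ℕ) (ν c : ℕ → ℝ) (s : ℕ) (t : ℝ) : ℝ :=
  ∑ j ∈ Finset.range r, c j * (Real.Gamma (ν j + 1) / Real.Gamma (ν j + 1 - s)) * t ^ (ν j - s)

lemma Sg_der (r : ℕ) (ν c : ℕ → ℝ) (hν : ∀ j, j < r → 0 < ν j ∧ ∀ n : ℤ, ν j ≠ (n : ℝ)) (s : ℕ) (t : ℝ)
    (ht : 0 < t) : HasDerivAt (Sg r ν c s) (Sg r ν c (s+1) t) t := by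
  unfold Sg
  apply HasDerivAt.fun_sum
  intro j hj
  have hn := (hν j (Finset.mem_range.1 hj)).2
  have d := (Real.hasDerivAt_rpow_const (x := t) (p := ν j - s) (Or.inl ht.ne')).const_mul
    (c j * (Real.Gamma (ν j + 1) / Real.Gamma (ν j + 1 - s)))
  refine d.congr_deriv ?_
  have hne : ν j - s ≠ 0 := fun h => hn s (by push_cast; linarith)
  have g : Gamma (ν j + 1 - s) = (ν j - s) * Gamma (ν j - s) := by
    rw [← Gamma_add_one hne]; congr 1; ring
  have e1 : ν j + 1 - ((s+1 : ℕ):ℝ) = ν j - s := by push_cast; ring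
  have e2 : ν j - ((s+1 : ℕ):ℝ) = ν j - s - 1 := by push_cast; ring
  rw [e1, e2, g]
  by_cases hg : Gamma (ν j - s) = 0
  · simp [hg]
  field_simp

lemma kappa_der {κ : ℝ → ℝ} (hκ : ContDiffOn ℝ (⊤ : ℕ∞) κ (Set.Ioo (-1 : ℝ) 1)) (s : ℕ) (x : ℝ)
    (hx : x ∈ Ioo (-1:ℝ) 1) : HasDerivAt (iteratedDeriv s κ) (iteratedDeriv (s+1) κ x) x := by
  have h := hκ.differentiableOn_iteratedDerivWithin (m := s) (by exact_mod_cast ENat.natCast_lt_top s) isOpen_Ioo.uniqueDiffOn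
  have h2 : DifferentiableAt ℝ (iteratedDeriv s κ) x := by
    refine ((h x hx).differentiableAt (isOpen_Ioo.mem_nhds hx)).congr_of_eventuallyEq ?_
    filter_upwards [isOpen_Ioo.mem_nhds hx] with y hy
    exact (iteratedDerivWithin_of_isOpen isOpen_Ioo hy).symm
  rw [iteratedDeriv_succ]
  exact h2.hasDerivAt

noncomputable def Fr (κ : ℝ → ℝ) (r : ℕ) (ν c1 cm1 : ℕ → ℝ) (s : ℕ) (x : ℝ) : ℝ :=
  iteratedDeriv s κ x - (-1)^s * Sg r ν c1 s (1-x) - Sg r ν cm1 s (1+x)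

lemma bounded_O {g : ℝ → ℝ} {e : ℝ} (he : e ≤ 0) (hg : ContinuousAt g 0) :
    g =O[𝓝[>] (0:ℝ)] fun t => t^e := by
  have h1 : g =O[𝓝[>] (0:ℝ)] fun _ => (1:ℝ) := (hg.tendsto.mono_left nhdsWithin_le_nhds).isBigO_one ℝ
  refine h1.trans (IsBigO.of_bound 1 ?_)
  filter_upwards [Ioo_mem_nhdsGT (show (0:ℝ) < 1 by norm_num)] with t ht
  rw [one_mul, norm_one, Real.norm_of_nonneg (rpow_nonneg ht.1.le e)]
  exact one_le_rpow_of_pos_of_le_one_of_nonpos ht.1 ht.2.le he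

lemma rpow_O {a e : ℝ} (he : e ≤ a) : (fun t : ℝ => t^a) =O[𝓝[>] (0:ℝ)] fun t => t^e := by
  refine IsBigO.of_bound 1 ?_
  filter_upwards [Ioo_mem_nhdsGT (show (0:ℝ) < 1 by norm_num)] with t ht
  rw [one_mul, Real.norm_of_nonneg (rpow_nonneg ht.1.le e), Real.norm_of_nonneg (rpow_nonneg ht.1.le a)]
  exact rpow_le_rpow_of_exponent_ge ht.1 ht.2.le he

lemma Fr_JB {κ : ℝ → ℝ} {r : ℕ} {ν c1 cm1 : ℕ → ℝ} {X : ℝ}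
    (hκ : ContDiffOn ℝ (⊤ : ℕ∞) κ (Set.Ioo (-1 : ℝ) 1))
    (hν : ∀ j, j < r → 0 < ν j ∧ ∀ n : ℤ, ν j ≠ (n : ℝ))
    (h1 : ∀ s : ℕ, ∃ p : Polynomial ℝ,
          (fun t : ℝ => iteratedDeriv s κ (1 - t) - (p.eval t + (-1 : ℝ) ^ s * Sg r ν c1 s t))
            =O[𝓝[>] (0 : ℝ)] fun t => t ^ (X - s))
    (h2 : ∀ s : ℕ, ∃ p : Polynomial ℝ,
          (fun t : ℝ => iteratedDeriv s κ (-1 + t) - (p.eval t + Sg r ν cm1 s t))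
            =O[𝓝[>] (0 : ℝ)] fun t => t ^ (X - s)) :
    JB X (Fr κ r ν c1 cm1) := by
  have hder : ∀ s, ∀ x ∈ Ioo (-1:ℝ) 1,
      HasDerivAt (Fr κ r ν c1 cm1 s) (Fr κ r ν c1 cm1 (s+1) x) x := by
    intro s x hx
    have a1 : 0 < 1 - x := by linarith [hx.2]
    have a2 : 0 < 1 + x := by linarith [hx.1]
    have d1 := (Sg_der r ν c1 hν s (1-x) a1).comp x ((hasDerivAt_id x).const_sub 1)
    have d2 := (Sg_der r ν cm1 hν s (1+x) a2).comp x ((hasDerivAt_id x).const_add 1)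
    refine HasDerivAt.congr_deriv (((kappa_der hκ s x hx).sub (d1.const_mul ((-1)^s))).sub d2) ?_
    simp only [Fr, pow_succ]
    ring
  refine ⟨hder, fun s => ?_⟩
  have he : min 0 (X - s) ≤ 0 := min_le_left _ _
  have hcS : ∀ c : ℕ → ℝ, ContinuousAt (Sg r ν c s) 2 := fun c =>
    (Sg_der r ν c hν s 2 (by norm_num)).continuousAt
  have hcS' : ∀ c : ℕ → ℝ, ContinuousAt (fun t => Sg r ν c s (2 - t)) 0 := fun c =>
    ContinuousAt.comp (g := Sg r ν c s) (f := fun t : ℝ => 2 - t) (x := 0) (by simpa using hcS c) (by fun_prop)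
  refine bd_global he (fun x hx => (hder s x hx).continuousAt.continuousWithinAt) ?_ ?_
  · obtain ⟨p, hp⟩ := h1 s
    have hp2 := hp.trans (rpow_O (min_le_right 0 (X - s)))
    have := (hp2.add (bounded_O he p.continuous.continuousAt)).sub (bounded_O he (hcS' cm1))
    refine this.congr_left fun t => ?_
    simp only [Fr, sub_sub_cancel, show 1 + (1 - t) = 2 - t by ring]
    ring
  · obtain ⟨p, hp⟩ := h2 s
    have hp2 := hp.trans (rpow_O (min_le_right 0 (X - s)))
    have := (hp2.add (bounded_O he p.continuous.continuousAt)).sub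
      ((bounded_O he (hcS' c1)).const_mul_left ((-1)^s))
    refine this.congr_left fun t => ?_
    simp only [Fr, show 1 - (-1 + t) = 2 - t by ring, show 1 + (-1 + t) = t by ring]
    ring


lemma sphere_pos (p : ℕ) (hp : 1 ≤ p) : 0 < sphereSurface p := by
  have : (0:ℝ) < p := by exact_mod_cast hp
  unfold sphereSurface
  have := Gamma_pos_of_pos (show (0:ℝ) < (p:ℝ)/2 by positivity)
  positivity

lemma Cc_ne (α ν : ℝ) (hα : 0 ≤ α) (hν : 0 < ν) (hn : ∀ n : ℤ, ν ≠ n) : Cc α ν ≠ 0 := by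
  have g1 := Gamma_pos_of_pos (show 0 < α + 1 by linarith)
  have g2 := Gamma_pos_of_pos (show 0 < ν + α + 1 by linarith)
  exact div_ne_zero (by positivity) (Gamma_neg_ne ν hn)

lemma split_int {α X : ℝ} (hα : 0 ≤ α) (hX : 0 < X) {κ : ℝ → ℝ} {r : ℕ} {ν c1 cm1 : ℕ → ℝ}
    (hν : ∀ j, j < r → 0 < ν j ∧ ∀ n : ℤ, ν j ≠ (n : ℝ))
    (hJ : JB X (Fr κ r ν c1 cm1)) (k : ℕ) :
    ∫ x in (-1:ℝ)..1, κ x * (LP α k).eval x * (1-x^2)^α =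
      (∫ x in (-1:ℝ)..1, Fr κ r ν c1 cm1 0 x * (LP α k).eval x * (1-x^2)^α) +
      ∑ j ∈ Finset.range r, c1 j * Acoef α (ν j) k +
      (-1)^k * ∑ j ∈ Finset.range r, cm1 j * Acoef α (ν j) k := by
  have i0 := JB_int_bd hα hJ (by linarith) (LP α k)
  have hw : Continuous (fun x : ℝ => (LP α k).eval x * (1-x^2)^α) :=
    (LP α k).continuous.mul (Continuous.rpow_const (by fun_prop) (fun _ => Or.inr hα))
  have hj1 : ∀ j ∈ Finset.range r, IntervalIntegrable
      (fun x : ℝ => c1 j * ((1-x)^(ν j) * (LP α k).eval x * (1-x^2)^α)) MeasureTheory.volume (-1) 1 := by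
    intro j hj
    have hp := (hν j (Finset.mem_range.1 hj)).1
    have : Continuous (fun x : ℝ => c1 j * ((1-x)^(ν j) * ((LP α k).eval x * (1-x^2)^α))) :=
      continuous_const.mul ((Continuous.rpow_const (by fun_prop) (fun _ => Or.inr hp.le)).mul hw)
    simp only [← mul_assoc] at this ⊢
    exact this.intervalIntegrable _ _
  have hj2 : ∀ j ∈ Finset.range r, IntervalIntegrable
      (fun x : ℝ => cm1 j * ((1+x)^(ν j) * (LP α k).eval x * (1-x^2)^α)) MeasureTheory.volume (-1) 1 := by
    intro j hj
    have hp := (hν j (Finset.mem_range.1 hj)).1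
    have : Continuous (fun x : ℝ => cm1 j * ((1+x)^(ν j) * ((LP α k).eval x * (1-x^2)^α))) :=
      continuous_const.mul ((Continuous.rpow_const (by fun_prop) (fun _ => Or.inr hp.le)).mul hw)
    simp only [← mul_assoc] at this ⊢
    exact this.intervalIntegrable _ _
  have e1 : ∑ j ∈ Finset.range r, c1 j * Acoef α (ν j) k = ∫ x in (-1:ℝ)..1, ∑ j ∈ Finset.range r,
      c1 j * ((1-x)^(ν j) * (LP α k).eval x * (1-x^2)^α) := by
    rw [intervalIntegral.integral_finsetSum hj1]
    apply Finset.sum_congr rfl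
    intro j _
    rw [intervalIntegral.integral_const_mul, Acoef]
  have e2 : (-1)^k * ∑ j ∈ Finset.range r, cm1 j * Acoef α (ν j) k = ∫ x in (-1:ℝ)..1, ∑ j ∈ Finset.range r,
      cm1 j * ((1+x)^(ν j) * (LP α k).eval x * (1-x^2)^α) := by
    rw [intervalIntegral.integral_finsetSum hj2, Finset.mul_sum]
    apply Finset.sum_congr rfl
    intro j _
    rw [intervalIntegral.integral_const_mul, Acoef_neg]; ring
  have s1 : IntervalIntegrable (fun x : ℝ => ∑ j ∈ Finset.range r,
      c1 j * ((1-x)^(ν j) * (LP α k).eval x * (1-x^2)^α)) MeasureTheory.volume (-1) 1 := by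
    have := IntervalIntegrable.sum (Finset.range r) hj1
    rw [Finset.sum_fn] at this
    exact this
  have s2 : IntervalIntegrable (fun x : ℝ => ∑ j ∈ Finset.range r,
      cm1 j * ((1+x)^(ν j) * (LP α k).eval x * (1-x^2)^α)) MeasureTheory.volume (-1) 1 := by
    have := IntervalIntegrable.sum (Finset.range r) hj2
    rw [Finset.sum_fn] at this
    exact this
  rw [e1, e2, ← intervalIntegral.integral_add i0 s1, ← intervalIntegral.integral_add (i0.add s1) s2]
  congr 1; ext x
  have hg : ∀ j ∈ Finset.range r, Real.Gamma (ν j + 1) / Real.Gamma (ν j + 1 - (0:ℕ)) = 1 := by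
    intro j hj
    have hp := (hν j (Finset.mem_range.1 hj)).1
    rw [Nat.cast_zero, sub_zero, div_self (Gamma_pos_of_pos (by linarith)).ne']
  have a1 : Sg r ν c1 0 (1-x) = ∑ j ∈ Finset.range r, c1 j * (1-x)^(ν j) := by
    apply Finset.sum_congr rfl
    intro j hj
    rw [hg j hj]; simp
  have a2 : Sg r ν cm1 0 (1+x) = ∑ j ∈ Finset.range r, cm1 j * (1+x)^(ν j) := by
    apply Finset.sum_congr rfl
    intro j hj
    rw [hg j hj]; simp
  have b1 : ∑ j ∈ Finset.range r, c1 j * ((1-x)^(ν j) * (LP α k).eval x * (1-x^2)^α) =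
      (∑ j ∈ Finset.range r, c1 j * (1-x)^(ν j)) * ((LP α k).eval x * (1-x^2)^α) := by
    rw [Finset.sum_mul]; exact Finset.sum_congr rfl fun _ _ => by ring
  have b2 : ∑ j ∈ Finset.range r, cm1 j * ((1+x)^(ν j) * (LP α k).eval x * (1-x^2)^α) =
      (∑ j ∈ Finset.range r, cm1 j * (1+x)^(ν j)) * ((LP α k).eval x * (1-x^2)^α) := by
    rw [Finset.sum_mul]; exact Finset.sum_congr rfl fun _ _ => by ring
  rw [b1, b2]
  simp only [Fr, a1, a2, iteratedDeriv_zero, pow_zero]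
  ring

lemma sum_tendsto {α : ℝ} (hα : 0 ≤ α) {r : ℕ} {ν c : ℕ → ℝ} (hr : 1 ≤ r)
    (hν : ∀ j, j < r → 0 < ν j ∧ ∀ n : ℤ, ν j ≠ (n : ℝ))
    (hmono : ∀ i j, i < j → j < r → ν i < ν j) :
    Tendsto (fun k : ℕ => (∑ j ∈ Finset.range r, c j * Acoef α (ν j) k) * (k:ℝ)^(2*ν 0+2*α+2)) atTop
      (𝓝 (c 0 * Cc α (ν 0))) := by
  have h : ∀ j ∈ Finset.range r, Tendsto (fun k : ℕ => c j * Acoef α (ν j) k * (k:ℝ)^(2*ν 0+2*α+2)) atTop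
      (𝓝 (if j = 0 then c 0 * Cc α (ν 0) else 0)) := by
    intro j hj
    have hj' := Finset.mem_range.1 hj
    have t := Acoef_tendsto α (ν j) hα (hν j hj').1 (hν j hj').2
    by_cases h0 : j = 0
    · subst h0
      simpa [mul_assoc] using t.const_mul (c 0)
    · rw [if_neg h0]
      have hlt := hmono 0 j (Nat.pos_of_ne_zero h0) hj'
      have t2 := (tendsto_rpow_neg_atTop (show 0 < 2 * ν j - 2 * ν 0 by linarith)).comp (tendsto_natCast_atTop_atTop (R := ℝ))
      have t3 := (t.mul t2).const_mul (c j)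
      rw [mul_zero, mul_zero] at t3
      refine t3.congr' ?_
      filter_upwards [eventually_gt_atTop 0] with k hk
      have hk' : (0:ℝ) < k := by exact_mod_cast hk
      simp only [Function.comp]
      have : (k:ℝ)^(2*ν 0+2*α+2) = (k:ℝ)^(2*ν j+2*α+2) * (k:ℝ)^(-(2 * ν j - 2 * ν 0)) := by
        rw [← rpow_add hk']; congr 1; ring
      rw [this]; ring
  have := tendsto_finsetSum (Finset.range r) h
  rw [Finset.sum_ite_eq' (Finset.range r) 0, if_pos (Finset.mem_range.2 hr)] at this
  refine this.congr fun k => ?_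
  rw [Finset.sum_mul]

lemma rem_tendsto {α ν₁ ε : ℝ} (hα : 0 ≤ α) (hν : 0 < ν₁) (hε : 0 < ε) {F : ℕ → ℝ → ℝ}
    (hJ : JB (ν₁ + 1 + ε) F) :
    Tendsto (fun k : ℕ => (∫ x in (-1:ℝ)..1, F 0 x * (LP α k).eval x * (1-x^2)^α) * (k:ℝ)^(2*ν₁+2*α+2))
      atTop (𝓝 0) := by
  set m := ⌈ν₁ + 1 + ε + α⌉₊ with hm
  obtain ⟨K, hK⟩ := decay hα m _ F hJ (Nat.ceil_lt_add_one (by linarith))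
  have hm2 : ν₁ + 1 + ε + α ≤ m := Nat.le_ceil _
  have t2 := ((tendsto_rpow_neg_atTop (show 0 < 2 * ε by linarith)).comp
    (tendsto_natCast_atTop_atTop (R := ℝ))).const_mul |K|
  rw [mul_zero] at t2
  refine squeeze_zero_norm' ?_ t2
  filter_upwards [eventually_ge_atTop 1] with k hk
  have hk' : (1:ℝ) ≤ k := by exact_mod_cast hk
  have hk0 : (0:ℝ) < k := by linarith
  rw [norm_mul, Real.norm_eq_abs, Real.norm_of_nonneg (by positivity)]
  simp only [Function.comp]
  have b : |∫ x in (-1:ℝ)..1, F 0 x * (LP α k).eval x * (1-x^2)^α| ≤ |K| / (k:ℝ)^(2*(m:ℝ)) := by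
    refine (hK k hk).trans ?_
    have : (k:ℝ)^(2*(m:ℝ)) = ((k:ℝ)*k)^m := by
      rw [rpow_mul hk0.le, rpow_natCast, rpow_two, sq]
    rw [this]
    have h2 : ((k:ℝ)*k)^m ≤ ((k:ℝ) * (k + 2*α + 1))^m := by gcongr; linarith
    calc _ ≤ |K| / ((k:ℝ) * (k + 2*α + 1))^m := by gcongr; exact le_abs_self K
      _ ≤ _ := by gcongr
  calc _ ≤ |K| / (k:ℝ)^(2*(m:ℝ)) * (k:ℝ)^(2*ν₁+2*α+2) := by gcongr
    _ = |K| * (k:ℝ)^(2*ν₁+2*α+2 - 2*m) := by rw [rpow_sub hk0]; ring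
    _ ≤ _ := by
      gcongr
      linarith

/-- Main theorem (full version): asymptotic decay of the Legendre coefficients `μ_k(κ)` from
the asymptotic expansions of `κ` and its derivatives at the endpoints `±1`. -/
theorem main_decay_full (d : ℕ) (hd : 3 ≤ d) (ν₁ : ℝ) (hν₁pos : 0 < ν₁)
    (hν₁nonint : ∀ n : ℤ, ν₁ ≠ (n : ℝ)) :
    ∃ C : ℝ, C ≠ 0 ∧
      ∀ (κ : ℝ → ℝ) (r : ℕ) (ν c1 cm1 : ℕ → ℝ) (ε : ℝ),
        1 ≤ r →
        ContDiffOn ℝ (⊤ : ℕ∞) κ (Set.Ioo (-1 : ℝ) 1) →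
        ν 0 = ν₁ →
        (∀ j, j < r → 0 < ν j ∧ ∀ n : ℤ, ν j ≠ (n : ℝ)) →
        (∀ i j, i < j → j < r → ν i < ν j) →
        0 < ε →
        (2 ≤ r → ε < ν 1 - ν₁) →
        (∀ s : ℕ, ∃ p : Polynomial ℝ,
          (fun t : ℝ => iteratedDeriv s κ (1 - t) -
              (p.eval t + (-1 : ℝ) ^ s * ∑ j ∈ Finset.range r,
                c1 j * (Real.Gamma (ν j + 1) / Real.Gamma (ν j + 1 - s)) * t ^ (ν j - s)))
            =O[𝓝[>] (0 : ℝ)] fun t => t ^ (ν₁ + 1 + ε - s)) →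
        (∀ s : ℕ, ∃ p : Polynomial ℝ,
          (fun t : ℝ => iteratedDeriv s κ (-1 + t) -
              (p.eval t + ∑ j ∈ Finset.range r,
                cm1 j * (Real.Gamma (ν j + 1) / Real.Gamma (ν j + 1 - s)) * t ^ (ν j - s)))
            =O[𝓝[>] (0 : ℝ)] fun t => t ^ (ν₁ + 1 + ε - s)) →
        ((c1 0 ≠ -cm1 0 →
            Tendsto (fun k : ℕ =>
                legendreCoeff d k κ /
                  ((c1 0 + cm1 0) * C * (k : ℝ) ^ (-(d : ℝ) - 2 * ν₁ + 1)))
              (atTop ⊓ 𝓟 {k | Even k}) (𝓝 1)) ∧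
         (c1 0 ≠ cm1 0 →
            Tendsto (fun k : ℕ =>
                legendreCoeff d k κ /
                  ((c1 0 - cm1 0) * C * (k : ℝ) ^ (-(d : ℝ) - 2 * ν₁ + 1)))
              (atTop ⊓ 𝓟 {k | Odd k}) (𝓝 1))) := by

  set α : ℝ := ((d:ℝ)-3)/2 with hαd
  have hd' : (3:ℝ) ≤ d := by exact_mod_cast hd
  have hα : 0 ≤ α := by rw [hαd]; linarith
  set ρ : ℝ := sphereSurface (d - 1) / sphereSurface d with hρ
  have hρ0 : ρ ≠ 0 := (div_pos (sphere_pos _ (by omega)) (sphere_pos _ (by omega))).ne'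
  have hC0 : ρ * Cc α ν₁ ≠ 0 := mul_ne_zero hρ0 (Cc_ne α ν₁ hα hν₁pos hν₁nonint)
  refine ⟨ρ * Cc α ν₁, hC0, ?_⟩
  intro κ r ν c1 cm1 ε hr hκ hν0 hν hmono hε _ h1 h2
  have hJ : JB (ν₁ + 1 + ε) (Fr κ r ν c1 cm1) := Fr_JB hκ hν h1 h2
  have hcoef : ∀ k, legendreCoeff d k κ = ρ * (
      (∫ x in (-1:ℝ)..1, Fr κ r ν c1 cm1 0 x * (LP α k).eval x * (1-x^2)^α) +
      ∑ j ∈ Finset.range r, c1 j * Acoef α (ν j) k +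
      (-1)^k * ∑ j ∈ Finset.range r, cm1 j * Acoef α (ν j) k) := by
    intro k
    rw [← split_int hα (by linarith) hν hJ k, legendreCoeff]
    congr 1
    apply integral_congr_Ioo'
    intro x hx
    rw [legendreP_eq d k x hx]
  have tR := rem_tendsto hα hν₁pos hε hJ
  have t1 := sum_tendsto (c := c1) hα hr hν hmono
  have t2 := sum_tendsto (c := cm1) hα hr hν hmono
  rw [hν0] at t1 t2
  have hE : ∀ k : ℕ, 0 < k → (k:ℝ)^(-(d:ℝ) - 2 * ν₁ + 1) = ((k:ℝ)^(2*ν₁+2*α+2))⁻¹ := by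
    intro k hk
    rw [← rpow_neg (by positivity)]
    congr 1; rw [hαd]; ring
  constructor
  · intro hne
    have hs : c1 0 + cm1 0 ≠ 0 := fun h => hne (by linarith)
    have t := (((tR.add t1).add t2).const_mul ρ).div_const ((c1 0 + cm1 0) * (ρ * Cc α ν₁))
    have e : ρ * (0 + c1 0 * Cc α ν₁ + cm1 0 * Cc α ν₁) / ((c1 0 + cm1 0) * (ρ * Cc α ν₁)) = 1 := by
      rw [div_eq_one_iff_eq (mul_ne_zero hs hC0)]; ring
    rw [e] at t
    refine (t.mono_left inf_le_left).congr' ?_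
    have ev : ∀ᶠ k : ℕ in atTop ⊓ 𝓟 {k | Even k}, 0 < k ∧ Even k :=
      ((eventually_gt_atTop 0).filter_mono inf_le_left).and
        ((eventually_principal.2 fun _ h => h).filter_mono inf_le_right)
    filter_upwards [ev] with k hk
    have hk' : (0:ℝ) < k := by exact_mod_cast hk.1
    rw [hcoef k, hE k hk.1, hk.2.neg_one_pow]
    have : (k:ℝ)^(2*ν₁+2*α+2) ≠ 0 := (rpow_pos_of_pos hk' _).ne'
    field_simp
  · intro hne
    have hs : c1 0 - cm1 0 ≠ 0 := fun h => hne (by linarith)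
    have t := (((tR.add t1).sub t2).const_mul ρ).div_const ((c1 0 - cm1 0) * (ρ * Cc α ν₁))
    have e : ρ * (0 + c1 0 * Cc α ν₁ - cm1 0 * Cc α ν₁) / ((c1 0 - cm1 0) * (ρ * Cc α ν₁)) = 1 := by
      rw [div_eq_one_iff_eq (mul_ne_zero hs hC0)]; ring
    rw [e] at t
    refine (t.mono_left inf_le_left).congr' ?_
    have ev : ∀ᶠ k : ℕ in atTop ⊓ 𝓟 {k | Odd k}, 0 < k ∧ Odd k :=
      ((eventually_gt_atTop 0).filter_mono inf_le_left).and
        ((eventually_principal.2 fun _ h => h).filter_mono inf_le_right)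
    filter_upwards [ev] with k hk
    have hk' : (0:ℝ) < k := by exact_mod_cast hk.1
    rw [hcoef k, hE k hk.1, hk.2.neg_one_pow]
    have : (k:ℝ)^(2*ν₁+2*α+2) ≠ 0 := (rpow_pos_of_pos hk' _).ne'
    field_simp
    ring
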